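/- arXiv:1212.6100 — 2 statements merged into one kernel-verified Lean document; each statement's English description precedes it below -/
import Mathlib

section
/- Suppose that liminf_{|x|→∞} [ inf_{z: |x|−1 ≤ |z| ≤ |x|−1/2} e^{−V(z)} ] / [ sup_{z: |x| ≤ |z| ≤ |x|+1} e^{−V(z)} ] = +∞. Then there exist constants C₂, C₃ > 0 such that for all s > 0 and all f ∈ C_b^∞(ℝ^d), μ_V(f²) ≤ s · 𝓔_{α,V}(f,f) + β(s) · μ_V(|f|)², where β(s) = C₂ (1 + s^{−d/α}) [Φ^{−1}(C₃ s^{−1})]^{d + d²/α} [K(Φ^{−1}(C₃ s^{−1}))]^{1 + d/α} [k(Φ^{−1}(C₃ s^{−1}))]^{−2 − d/α}. -/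
open MeasureTheory Real Set Metric Filter

noncomputable section

/-- Euclidean space `ℝ^d`. -/
abbrev Ed (d : ℕ) := EuclideanSpace ℝ (Fin d)

/-- The probability measure `μ_V(dx) = C_V e^{-V(x)} dx` with `C_V = (∫ e^{-V})⁻¹`. -/
def muV (d : ℕ) (V : Ed d → ℝ) : Measure (Ed d) :=
  (volume : Measure (Ed d)).withDensity
    fun x => ENNReal.ofReal ((∫ y, Real.exp (-V y))⁻¹ * Real.exp (-V x))

/-- `f ∈ C_b^∞(ℝ^d)`: smooth with bounded derivatives of every order. -/
def CbSmooth (d : ℕ) (f : Ed d → ℝ) : Prop :=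
  ContDiff ℝ (⊤ : ℕ∞) f ∧ ∀ n : ℕ, ∃ C : ℝ, ∀ x, ‖iteratedFDeriv ℝ n f x‖ ≤ C

/-- `V` is locally bounded. -/
def LocallyBounded (d : ℕ) (V : Ed d → ℝ) : Prop :=
  ∀ r : ℝ, ∃ M : ℝ, ∀ x : Ed d, ‖x‖ ≤ r → |V x| ≤ M

/-- The nonlocal Dirichlet form with finite range jumps `𝓔_{α,V}`. -/
def formE (d : ℕ) (α : ℝ) (V f : Ed d → ℝ) : ℝ :=
  (1/2) * ∫ x, (∫ y in {y : Ed d | dist x y ≤ 1},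
      (f x - f y) ^ 2 / dist x y ^ ((d : ℝ) + α)) ∂(muV d V)

/-- The nonlocal Dirichlet form with large jumps `𝓓_{α,V}`. -/
def formD (d : ℕ) (α : ℝ) (V f : Ed d → ℝ) : ℝ :=
  (1/2) * ∫ x, (∫ y in {y : Ed d | 1 < dist x y},
      (f x - f y) ^ 2 / dist x y ^ ((d : ℝ) + α)) ∂(muV d V)

/-- `inf_{z : |x|-1 ≤ |z| ≤ |x|-1/2} e^{-V(z)}`. -/
def infAnn (d : ℕ) (V : Ed d → ℝ) (x : Ed d) : ℝ :=
  sInf ((fun z => Real.exp (-V z)) '' {z : Ed d | ‖x‖ - 1 ≤ ‖z‖ ∧ ‖z‖ ≤ ‖x‖ - 1/2})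

/-- `sup_{z : |x| ≤ |z| ≤ |x|+1} e^{-V(z)}`. -/
def supAnn (d : ℕ) (V : Ed d → ℝ) (x : Ed d) : ℝ :=
  sSup ((fun z => Real.exp (-V z)) '' {z : Ed d | ‖x‖ ≤ ‖z‖ ∧ ‖z‖ ≤ ‖x‖ + 1})

/-- `K(r) = sup_{|x| ≤ r} e^{-V(x)}`. -/
def Kfun (d : ℕ) (V : Ed d → ℝ) (r : ℝ) : ℝ :=
  sSup ((fun x => Real.exp (-V x)) '' {x : Ed d | ‖x‖ ≤ r})

/-- `k(r) = inf_{|x| ≤ r+1} e^{-V(x)}`. -/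
def kfun (d : ℕ) (V : Ed d → ℝ) (r : ℝ) : ℝ :=
  sInf ((fun x => Real.exp (-V x)) '' {x : Ed d | ‖x‖ ≤ r + 1})

/-- The constant `(1/α)·2^{2d+1}·(e + e^{1/2})·(2^α − 1)`. -/
def thresholdConst (d : ℕ) (α : ℝ) : ℝ :=
  (1/α) * (2:ℝ) ^ (2*d+1) * (Real.exp 1 + Real.exp (1/2)) * ((2:ℝ) ^ α - 1)

/-- `Φ(r) = inf_{|x| ≥ r} ( e^{V(x)} · inf_{|x|-1 ≤ |z| ≤ |x|-1/2} e^{-V(z)} )`. -/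
def Phi (d : ℕ) (V : Ed d → ℝ) (r : ℝ) : ℝ :=
  sInf ((fun x => Real.exp (V x) * infAnn d V x) '' {x : Ed d | r ≤ ‖x‖})

/-- Generalized inverse `Φ⁻¹(t) = inf { r > 0 : Φ(r) ≥ t }`. -/
def PhiInv (d : ℕ) (V : Ed d → ℝ) (t : ℝ) : ℝ :=
  sInf {r : ℝ | 0 < r ∧ t ≤ Phi d V r}

open scoped ENNReal NNReal

lemma lintegral_closedBall_swap {d : ℕ} (ρ : ℝ) {H : Ed d → Ed d → ℝ≥0∞}
    (hH : Measurable (Function.uncurry H)) :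
    ∫⁻ x, ∫⁻ z in closedBall x ρ, H x z = ∫⁻ z, ∫⁻ x in closedBall z ρ, H x z := by
  have hset : MeasurableSet {p : Ed d × Ed d | dist p.1 p.2 ≤ ρ} :=
    measurableSet_le (measurable_fst.dist measurable_snd) measurable_const
  have h := lintegral_lintegral_swap (μ := (volume : Measure (Ed d)))
    (ν := (volume : Measure (Ed d)))
    (f := fun x z => {p : Ed d × Ed d | dist p.1 p.2 ≤ ρ}.indicator (Function.uncurry H) (x, z))
    (hH.indicator hset).aemeasurable
  convert h using 3 with x x
  · rw [← lintegral_indicator measurableSet_closedBall]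
    refine lintegral_congr fun z => ?_
    simp [indicator, dist_comm z x]
  · rw [← lintegral_indicator measurableSet_closedBall]
    refine lintegral_congr fun z => ?_
    simp [indicator]

/-- The carré du champ of the finite range jump kernel, as an extended nonnegative number. -/
def jumpDensity {d : ℕ} (p : ℝ) (f : Ed d → ℝ) (x : Ed d) : ℝ≥0∞ :=
  ∫⁻ y in closedBall x 1, ENNReal.ofReal ((f x - f y) ^ 2 / dist x y ^ p)

/-- The jump energy of `f` with respect to the measure with density `W`. -/
def jumpEnergy {d : ℕ} (p : ℝ) (W : Ed d → ℝ≥0∞) (f : Ed d → ℝ) : ℝ≥0∞ :=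
  ∫⁻ x, W x * jumpDensity p f x

lemma measurable_jump_kernel {d : ℕ} {f : Ed d → ℝ} (hf : Measurable f) (p : ℝ) :
    Measurable (fun q : Ed d × Ed d =>
      ENNReal.ofReal ((f q.1 - f q.2) ^ 2 / dist q.1 q.2 ^ p)) := by
  have : Measurable (fun q : Ed d × Ed d => dist q.1 q.2) := measurable_fst.dist measurable_snd
  fun_prop

lemma measurable_lintegral_closedBall {d : ℕ} (ρ : ℝ) {H : Ed d × Ed d → ℝ≥0∞}
    (hH : Measurable H) : Measurable (fun x => ∫⁻ y in closedBall x ρ, H (x, y)) := by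
  have hset : MeasurableSet {p : Ed d × Ed d | dist p.1 p.2 ≤ ρ} :=
    measurableSet_le (measurable_fst.dist measurable_snd) measurable_const
  convert (hH.indicator hset).lintegral_prod_right' (ν := (volume : Measure (Ed d))) using 2 with x
  rw [← lintegral_indicator measurableSet_closedBall]
  refine lintegral_congr fun z => ?_
  simp [indicator, dist_comm z x]

lemma measurable_jumpDensity {d : ℕ} {f : Ed d → ℝ} (hf : Measurable f) (p : ℝ) :
    Measurable (jumpDensity p f) :=
  measurable_lintegral_closedBall 1 (measurable_jump_kernel hf p)

lemma sq_sub_le_rpow_mul {d : ℕ} (f : Ed d → ℝ) {p h : ℝ} (hp : 0 ≤ p) {x z : Ed d}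
    (hxz : dist x z ≤ h) :
    (f x - f z) ^ 2 ≤ h ^ p * ((f x - f z) ^ 2 / dist x z ^ p) := by
  rcases eq_or_ne x z with rfl | hne
  · simp
  · have hpos : 0 < dist x z ^ p := Real.rpow_pos_of_pos (dist_pos.2 hne) p
    rw [mul_div_assoc', le_div_iff₀ hpos, mul_comm]
    gcongr

lemma tail_le_jumpEnergy {d : ℕ} {p : ℝ} (hp : 0 ≤ p) {W : Ed d → ℝ≥0∞} (hW : Measurable W)
    {f : Ed d → ℝ} (hf : Measurable f) {r : ℝ} (hr : 1 ≤ r) {t : ℝ≥0∞}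
    (ht : ∀ x z : Ed d, r < ‖x‖ → ‖x‖ - 1 ≤ ‖z‖ → ‖z‖ ≤ ‖x‖ - 1 / 2 → t * W x ≤ W z) :
    t * volume (closedBall (0 : Ed d) (1 / 4)) *
        ∫⁻ x in {x | r < ‖x‖}, W x * ENNReal.ofReal (f x ^ 2) ≤
      2 * jumpEnergy p W f +
        2 * volume (closedBall (0 : Ed d) 1) * ∫⁻ x, W x * ENNReal.ofReal (f x ^ 2) := by
  have hpt : ∀ x : Ed d, r < ‖x‖ →
      t * volume (closedBall (0 : Ed d) (1 / 4)) * (W x * ENNReal.ofReal (f x ^ 2)) ≤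
        ∫⁻ z in closedBall x 1, W z *
          (2 * ENNReal.ofReal ((f x - f z) ^ 2) + 2 * ENNReal.ofReal (f z ^ 2)) := by
    intro x hx
    have hx1 : 1 < ‖x‖ := hr.trans_lt hx
    have hx0 : ‖x‖ ≠ 0 := by positivity
    set c : Ed d := (1 - 3 / (4 * ‖x‖)) • x with hc
    have hcn : ‖c‖ = ‖x‖ - 3 / 4 := by
      rw [hc, norm_smul, Real.norm_of_nonneg]
      · field_simp
      · rw [sub_nonneg, div_le_one (by positivity)]; linarith
    have hcx : dist c x = 3 / 4 := by
      have : c - x = (-(3 / (4 * ‖x‖))) • x := by rw [hc]; module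
      rw [dist_eq_norm, this, norm_smul, norm_neg, Real.norm_of_nonneg (by positivity)]
      field_simp
    have hsub : closedBall c (1 / 4) ⊆ closedBall x 1 :=
      closedBall_subset_closedBall' (by rw [hcx]; norm_num)
    have hvol : volume (closedBall (0 : Ed d) (1 / 4)) = volume (closedBall c (1 / 4)) :=
      (Measure.addHaar_closedBall_center volume c _).symm
    calc _ = ∫⁻ _ in closedBall c (1 / 4), t * W x * ENNReal.ofReal (f x ^ 2) := by
            rw [setLIntegral_const, hvol]; ring
      _ ≤ ∫⁻ z in closedBall c (1 / 4), W z *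
          (2 * ENNReal.ofReal ((f x - f z) ^ 2) + 2 * ENNReal.ofReal (f z ^ 2)) := by
            refine setLIntegral_mono' measurableSet_closedBall fun z hz => ?_
            have hz1 : |‖z‖ - ‖c‖| ≤ 1 / 4 := by
              refine (abs_norm_sub_norm_le z c).trans ?_
              rwa [mem_closedBall, dist_eq_norm] at hz
            rw [abs_le, hcn] at hz1
            refine mul_le_mul' (ht x z hx (by linarith) (by linarith)) ?_
            have h2 : (2 : ℝ≥0∞) = ENNReal.ofReal 2 := by simp
            rw [h2, ← ENNReal.ofReal_mul (by norm_num), ← ENNReal.ofReal_mul (by norm_num),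
              ← ENNReal.ofReal_add (by positivity) (by positivity)]
            refine ENNReal.ofReal_le_ofReal ?_
            nlinarith [sq_nonneg (f x - 2 * f z)]
      _ ≤ _ := lintegral_mono_set hsub
  have hmeas : Measurable (Function.uncurry fun x z : Ed d => W z *
      (2 * ENNReal.ofReal ((f x - f z) ^ 2) + 2 * ENNReal.ofReal (f z ^ 2))) := by
    unfold Function.uncurry
    fun_prop
  have hset : MeasurableSet {x : Ed d | r < ‖x‖} := measurableSet_lt measurable_const measurable_norm
  calc _ = ∫⁻ x in {x | r < ‖x‖}, t * volume (closedBall (0 : Ed d) (1 / 4)) *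
          (W x * ENNReal.ofReal (f x ^ 2)) := by
        rw [lintegral_const_mul _ (by fun_prop)]
    _ ≤ ∫⁻ x in {x | r < ‖x‖}, ∫⁻ z in closedBall x 1, W z *
          (2 * ENNReal.ofReal ((f x - f z) ^ 2) + 2 * ENNReal.ofReal (f z ^ 2)) :=
        setLIntegral_mono' hset hpt
    _ ≤ ∫⁻ x, ∫⁻ z in closedBall x 1, W z *
          (2 * ENNReal.ofReal ((f x - f z) ^ 2) + 2 * ENNReal.ofReal (f z ^ 2)) :=
        setLIntegral_le_lintegral _ _
    _ = ∫⁻ z, ∫⁻ x in closedBall z 1, W z *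
          (2 * ENNReal.ofReal ((f x - f z) ^ 2) + 2 * ENNReal.ofReal (f z ^ 2)) :=
        lintegral_closedBall_swap 1 hmeas
    _ ≤ ∫⁻ z, (2 * (W z * jumpDensity p f z) +
          2 * volume (closedBall (0 : Ed d) 1) * (W z * ENNReal.ofReal (f z ^ 2))) := by
        refine lintegral_mono fun z => ?_
        rw [lintegral_const_mul _ (by fun_prop), lintegral_add_right _ measurable_const,
          lintegral_const_mul _ (by fun_prop), setLIntegral_const,
          Measure.addHaar_closedBall_center volume z, mul_add]
        refine add_le_add ?_ (le_of_eq (by ring))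
        rw [mul_left_comm]
        gcongr 2 * (W z * ?_)
        refine setLIntegral_mono' measurableSet_closedBall fun x hx => ENNReal.ofReal_le_ofReal ?_
        have := sq_sub_le_rpow_mul f hp (mem_closedBall'.1 hx)
        rw [Real.one_rpow, one_mul] at this
        rwa [← neg_sub, neg_sq]
    _ = _ := by
        have h1 := measurable_jumpDensity hf p
        rw [lintegral_add_right _ (by fun_prop), lintegral_const_mul _ (by fun_prop),
          lintegral_const_mul _ (by fun_prop), jumpEnergy]

lemma volume_mul_sq_le_jumpDensity {d : ℕ} {p : ℝ} (hp : 0 ≤ p) {f : Ed d → ℝ}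
    (hf : Measurable f) {h : ℝ} (h0 : 0 ≤ h) (h1 : h ≤ 1) (x : Ed d) :
    volume (closedBall (0 : Ed d) h) * ENNReal.ofReal (f x ^ 2) ≤
      ENNReal.ofReal (h ^ p) * jumpDensity p f x +
        2 * ENNReal.ofReal |f x| * ∫⁻ z in closedBall x h, ENNReal.ofReal |f z| := by
  calc _ = ∫⁻ _ in closedBall x h, ENNReal.ofReal (f x ^ 2) := by
        rw [setLIntegral_const, Measure.addHaar_closedBall_center volume x, mul_comm]
    _ ≤ ∫⁻ z in closedBall x h, (ENNReal.ofReal (h ^ p) *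
          ENNReal.ofReal ((f x - f z) ^ 2 / dist x z ^ p) +
          2 * ENNReal.ofReal |f x| * ENNReal.ofReal |f z|) := by
        refine setLIntegral_mono' measurableSet_closedBall fun z hz => ?_
        have h2 : 2 * ENNReal.ofReal |f x| = ENNReal.ofReal (2 * |f x|) := by
          rw [ENNReal.ofReal_mul (by norm_num), ENNReal.ofReal_ofNat]
        have hs := sq_sub_le_rpow_mul f hp (mem_closedBall'.1 hz)
        have hh : 0 ≤ h ^ p := Real.rpow_nonneg h0 p
        have hd' : 0 ≤ (f x - f z) ^ 2 / dist x z ^ p := by positivity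
        rw [h2, ← ENNReal.ofReal_mul hh, ← ENNReal.ofReal_mul (by positivity),
          ← ENNReal.ofReal_add (by positivity) (by positivity)]
        refine ENNReal.ofReal_le_ofReal ?_
        have := le_abs_self (f x * f z)
        rw [abs_mul] at this
        nlinarith [sq_nonneg (f z)]
    _ = ENNReal.ofReal (h ^ p) * (∫⁻ y in closedBall x h,
          ENNReal.ofReal ((f x - f y) ^ 2 / dist x y ^ p)) +
          2 * ENNReal.ofReal |f x| * ∫⁻ z in closedBall x h, ENNReal.ofReal |f z| := by
        have h3 : Measurable fun z => ENNReal.ofReal ((f x - f z) ^ 2 / dist x z ^ p) := by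
          have : Measurable (dist x) := measurable_const.dist measurable_id
          fun_prop
        rw [lintegral_add_right _ (by fun_prop), lintegral_const_mul _ h3,
          lintegral_const_mul _ (by fun_prop)]
    _ ≤ _ := by
        gcongr ?_ + _
        exact mul_le_mul_right (lintegral_mono_set (closedBall_subset_closedBall h1)) _

lemma local_le_jumpEnergy {d : ℕ} {p : ℝ} (hp : 0 ≤ p) {W : Ed d → ℝ≥0∞} (hW : Measurable W)
    {f : Ed d → ℝ} (hf : Measurable f) {r h : ℝ} (h0 : 0 ≤ h) (h1 : h ≤ 1) {κ : ℝ≥0∞}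
    (hκ : ∀ z : Ed d, ‖z‖ ≤ r + 1 → κ ≤ W z) :
    κ * volume (closedBall (0 : Ed d) h) *
        ∫⁻ x in {x | ‖x‖ ≤ r}, W x * ENNReal.ofReal (f x ^ 2) ≤
      κ * ENNReal.ofReal (h ^ p) * jumpEnergy p W f +
        2 * (∫⁻ x, W x * ENNReal.ofReal |f x|) ^ 2 := by
  have hker := measurable_jumpDensity hf p
  have hset : MeasurableSet {x : Ed d | ‖x‖ ≤ r} := measurableSet_le measurable_norm measurable_const
  set M := ∫⁻ x, W x * ENNReal.ofReal |f x| with hM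
  have hpt : ∀ x : Ed d, ‖x‖ ≤ r →
      κ * volume (closedBall (0 : Ed d) h) * (W x * ENNReal.ofReal (f x ^ 2)) ≤
        κ * ENNReal.ofReal (h ^ p) * (W x * jumpDensity p f x) +
        2 * M * (W x * ENNReal.ofReal |f x|) := by
    intro x hx
    have hmass : κ * ∫⁻ z in closedBall x h, ENNReal.ofReal |f z| ≤ M := by
      rw [← lintegral_const_mul _ (by fun_prop)]
      refine (setLIntegral_mono' measurableSet_closedBall fun z hz => ?_).trans
        (setLIntegral_le_lintegral (closedBall x h) _)
      have hzx : ‖z‖ ≤ r + 1 := by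
        have h2 := norm_le_norm_add_norm_sub x z
        rw [mem_closedBall', dist_eq_norm] at hz
        linarith
      gcongr
      exact hκ z hzx
    calc _ = κ * W x * (volume (closedBall (0 : Ed d) h) * ENNReal.ofReal (f x ^ 2)) := by ring
      _ ≤ κ * W x * (ENNReal.ofReal (h ^ p) * jumpDensity p f x +
          2 * ENNReal.ofReal |f x| * ∫⁻ z in closedBall x h, ENNReal.ofReal |f z|) :=
        mul_le_mul_right (volume_mul_sq_le_jumpDensity hp hf h0 h1 x) _
      _ = κ * ENNReal.ofReal (h ^ p) * (W x * jumpDensity p f x) +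
          2 * (κ * ∫⁻ z in closedBall x h, ENNReal.ofReal |f z|) *
            (W x * ENNReal.ofReal |f x|) := by ring
      _ ≤ _ := by gcongr
  calc _ = ∫⁻ x in {x | ‖x‖ ≤ r}, κ * volume (closedBall (0 : Ed d) h) *
          (W x * ENNReal.ofReal (f x ^ 2)) := by
        rw [lintegral_const_mul _ (by fun_prop)]
    _ ≤ _ := setLIntegral_mono' hset hpt
    _ ≤ _ := setLIntegral_le_lintegral _ _
    _ = _ := by
        rw [lintegral_add_right _ (by fun_prop), lintegral_const_mul _ (by fun_prop),
          lintegral_const_mul _ (by fun_prop), ← hM, jumpEnergy]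
        ring

lemma jumpDensity_le_of_lipschitzWith {d : ℕ} {p : ℝ} {f : Ed d → ℝ} {L : ℝ≥0}
    (hf : LipschitzWith L f) (x : Ed d) :
    jumpDensity p f x ≤
      ∫⁻ u in closedBall (0 : Ed d) 1, ENNReal.ofReal ((L : ℝ) ^ 2 * ‖u‖ ^ (2 - p)) := by
  have htrans := lintegral_sub_left_eq_self (μ := (volume : Measure (Ed d)))
    ((closedBall (0 : Ed d) 1).indicator
      fun u => ENNReal.ofReal ((L : ℝ) ^ 2 * ‖u‖ ^ (2 - p))) x
  rw [← lintegral_indicator measurableSet_closedBall, ← htrans, jumpDensity,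
    ← lintegral_indicator measurableSet_closedBall]
  refine lintegral_mono fun y => ?_
  by_cases hy : y ∈ closedBall x 1
  · have hy' : x - y ∈ closedBall (0 : Ed d) 1 := by
      rwa [mem_closedBall_zero_iff, ← dist_eq_norm, ← mem_closedBall']
    rw [indicator_of_mem hy, indicator_of_mem hy']
    refine ENNReal.ofReal_le_ofReal ?_
    rcases eq_or_ne x y with rfl | hne
    · simp only [sub_self, ne_eq, OfNat.ofNat_ne_zero, not_false_eq_true, zero_pow, zero_div]
      positivity
    · have hpos : 0 < ‖x - y‖ := norm_pos_iff.2 (sub_ne_zero.2 hne)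
      rw [dist_eq_norm, Real.rpow_sub hpos, Real.rpow_two, ← mul_div_assoc, ← mul_pow]
      have h := hf.dist_le_mul x y
      rw [Real.dist_eq, dist_eq_norm] at h
      refine div_le_div_of_nonneg_right ?_ (by positivity)
      rw [← sq_abs]
      gcongr
  · simp [indicator_of_notMem hy]

lemma lintegral_norm_rpow_lt_top {d : ℕ} (hd : 1 ≤ d) {p : ℝ} (hp : p < d + 2) (C : ℝ) :
    ∫⁻ u in closedBall (0 : Ed d) 1, ENNReal.ofReal (C * ‖u‖ ^ (2 - p)) < ∞ := by
  have hint : IntegrableOn (fun u : Ed d => C * ‖u‖ ^ (2 - p)) (ball 0 2) := by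
    refine integrableOn_ball_of_norm_le_rpow (C := |C|) (α := p - 2) (by simpa using hd)
      (by simp; linarith) ?_ (Measurable.aestronglyMeasurable (by fun_prop))
    refine ae_of_all _ fun u => ?_
    rw [norm_mul, Real.norm_eq_abs C, Real.norm_of_nonneg (by positivity), neg_sub]
  exact (hint.mono_set (closedBall_subset_ball (by norm_num))).lintegral_lt_top

lemma muV_lintegral {d : ℕ} {V : Ed d → ℝ} (hV : Measurable V) {g : Ed d → ℝ≥0∞}
    (hg : Measurable g) :
    ∫⁻ x, g x ∂(muV d V) =
      ∫⁻ x, ENNReal.ofReal ((∫ y, Real.exp (-V y))⁻¹ * Real.exp (-V x)) * g x := by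
  rw [muV, lintegral_withDensity_eq_lintegral_mul _ (by fun_prop) hg]
  rfl

lemma isProbabilityMeasure_muV {d : ℕ} {V : Ed d → ℝ}
    (hVint : Integrable (fun x => Real.exp (-V x))) : IsProbabilityMeasure (muV d V) := by
  have hpos : 0 < ∫ y, Real.exp (-V y) := integral_exp_pos hVint
  refine ⟨?_⟩
  rw [muV, withDensity_apply _ MeasurableSet.univ, Measure.restrict_univ,
    ← ofReal_integral_eq_lintegral_ofReal (hVint.const_mul _) (ae_of_all _ fun x => by positivity),
    integral_const_mul, inv_mul_cancel₀ hpos.ne', ENNReal.ofReal_one]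

lemma CbSmooth.exists_lipschitzWith {d : ℕ} {f : Ed d → ℝ} (hf : CbSmooth d f) :
    ∃ L, LipschitzWith L f := by
  obtain ⟨C, hC⟩ := hf.2 1
  refine ⟨C.toNNReal, lipschitzWith_of_nnnorm_fderiv_le
    (hf.1.differentiable (by simp)) fun x => ?_⟩
  rw [← NNReal.coe_le_coe, coe_nnnorm, ← norm_iteratedFDeriv_one]
  exact (hC x).trans (Real.le_coe_toNNReal C)

lemma CbSmooth.exists_abs_le {d : ℕ} {f : Ed d → ℝ} (hf : CbSmooth d f) :
    ∃ C, ∀ x, |f x| ≤ C := by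
  obtain ⟨C, hC⟩ := hf.2 0
  exact ⟨C, fun x => by simpa [norm_iteratedFDeriv_zero] using hC x⟩

lemma formE_nonneg {d : ℕ} (α : ℝ) (V f : Ed d → ℝ) : 0 ≤ formE d α V f := by
  refine mul_nonneg (by norm_num) (integral_nonneg fun x => integral_nonneg fun y => ?_)
  positivity

lemma jumpEnergy_eq_formE {d : ℕ} (hd : 1 ≤ d) {α : ℝ} (hα : α < 2) {V : Ed d → ℝ}
    (hV : Measurable V) (hVint : Integrable (fun x => Real.exp (-V x))) {f : Ed d → ℝ}
    (hf : CbSmooth d f) :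
    jumpEnergy ((d : ℝ) + α)
      (fun x => ENNReal.ofReal ((∫ y, Real.exp (-V y))⁻¹ * Real.exp (-V x))) f =
      ENNReal.ofReal (2 * formE d α V f) := by
  have := isProbabilityMeasure_muV hVint
  have hfm : Measurable f := hf.1.continuous.measurable
  have hJm := measurable_jumpDensity hfm ((d : ℝ) + α)
  obtain ⟨L, hL⟩ := hf.exists_lipschitzWith
  set J := ∫⁻ u in closedBall (0 : Ed d) 1,
    ENNReal.ofReal ((L : ℝ) ^ 2 * ‖u‖ ^ (2 - ((d : ℝ) + α))) with hJ
  have hJtop : J < ∞ := lintegral_norm_rpow_lt_top hd (by linarith) _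
  have hle : ∀ x, jumpDensity ((d : ℝ) + α) f x ≤ J := jumpDensity_le_of_lipschitzWith hL
  have hinner : ∀ x, ∫ y in {y : Ed d | dist x y ≤ 1}, (f x - f y) ^ 2 / dist x y ^ ((d : ℝ) + α)
      = (jumpDensity ((d : ℝ) + α) f x).toReal := by
    intro x
    have hset : {y : Ed d | dist x y ≤ 1} = closedBall x 1 := by
      ext y; simp [dist_comm]
    have hm : Measurable fun y => (f x - f y) ^ 2 / dist x y ^ ((d : ℝ) + α) := by
      have : Measurable (dist x) := measurable_const.dist measurable_id
      fun_prop
    rw [hset, integral_eq_lintegral_of_nonneg_ae (ae_of_all _ fun y => by positivity)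
      hm.aestronglyMeasurable, jumpDensity]
  have hE : jumpEnergy ((d : ℝ) + α)
      (fun x => ENNReal.ofReal ((∫ y, Real.exp (-V y))⁻¹ * Real.exp (-V x))) f =
      ∫⁻ x, jumpDensity ((d : ℝ) + α) f x ∂(muV d V) := (muV_lintegral hV hJm).symm
  have hfin : ∫⁻ x, jumpDensity ((d : ℝ) + α) f x ∂(muV d V) ≠ ∞ := by
    refine ((lintegral_mono hle).trans_lt ?_).ne
    simpa using hJtop
  rw [hE, formE]
  simp_rw [hinner]
  rw [integral_toReal hJm.aemeasurable (ae_of_all _ fun x => (hle x).trans_lt hJtop),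
    ← mul_assoc, mul_one_div_cancel two_ne_zero, one_mul, ENNReal.ofReal_toReal hfin]

lemma exists_tail_local_decomposition {d : ℕ} (hd : 1 ≤ d) {α : ℝ} (hα : 0 < α ∧ α < 2)
    {V : Ed d → ℝ} (hV : Measurable V) (hVint : Integrable (fun x => Real.exp (-V x)))
    {f : Ed d → ℝ} (hf : CbSmooth d f) {r t κ h : ℝ} (hr : 1 ≤ r) (ht0 : 0 ≤ t)
    (ht : ∀ x z : Ed d, r < ‖x‖ → ‖x‖ - 1 ≤ ‖z‖ → ‖z‖ ≤ ‖x‖ - 1 / 2 →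
      t * Real.exp (-V x) ≤ Real.exp (-V z))
    (hκ0 : 0 ≤ κ) (hκ : ∀ z : Ed d, ‖z‖ ≤ r + 1 → κ ≤ Real.exp (-V z))
    (h0 : 0 ≤ h) (h1 : h ≤ 1) :
    ∃ T L : ℝ, ∫ x, f x ^ 2 ∂(muV d V) = T + L ∧
      t * volume.real (closedBall (0 : Ed d) (1 / 4)) * T ≤ 4 * formE d α V f +
        2 * volume.real (closedBall (0 : Ed d) 1) * ∫ x, f x ^ 2 ∂(muV d V) ∧
      (∫ y, Real.exp (-V y))⁻¹ * κ * (h ^ d * volume.real (closedBall (0 : Ed d) 1)) * L ≤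
        (∫ y, Real.exp (-V y))⁻¹ * κ * h ^ ((d : ℝ) + α) * (2 * formE d α V f) +
          2 * (∫ x, |f x| ∂(muV d V)) ^ 2 := by
  have := isProbabilityMeasure_muV hVint
  have hp : 0 ≤ (d : ℝ) + α := by linarith [hα.1, Nat.cast_nonneg (α := ℝ) d]
  have hc : 0 < (∫ y, Real.exp (-V y))⁻¹ := inv_pos.2 (integral_exp_pos hVint)
  have hfc : Continuous f := hf.1.continuous
  have hfm : Measurable f := hfc.measurable
  have hE0 := formE_nonneg α V f
  obtain ⟨C, hC⟩ := hf.exists_abs_le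
  have hE := jumpEnergy_eq_formE hd hα.2 hV hVint hf
  set c := (∫ y, Real.exp (-V y))⁻¹ with hcdef
  set W : Ed d → ℝ≥0∞ := fun x => ENNReal.ofReal (c * Real.exp (-V x)) with hWdef
  have hW : Measurable W := by fun_prop
  have hint1 : Integrable (fun x => |f x|) (muV d V) :=
    Integrable.of_bound (by fun_prop) C (ae_of_all _ fun x => by simpa using hC x)
  have hint2 : Integrable (fun x => f x ^ 2) (muV d V) :=
    Integrable.of_bound (by fun_prop) (C ^ 2) (ae_of_all _ fun x => by
      rw [norm_pow, Real.norm_eq_abs]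
      exact pow_le_pow_left₀ (abs_nonneg _) (hC x) 2)
  have hM : ∫⁻ x, W x * ENNReal.ofReal |f x| = ENNReal.ofReal (∫ x, |f x| ∂(muV d V)) := by
    rw [ofReal_integral_eq_lintegral_ofReal hint1 (ae_of_all _ fun x => abs_nonneg _),
      muV_lintegral hV (by fun_prop)]
  have hA : ∫⁻ x, W x * ENNReal.ofReal (f x ^ 2) = ENNReal.ofReal (∫ x, f x ^ 2 ∂(muV d V)) := by
    rw [ofReal_integral_eq_lintegral_ofReal hint2 (ae_of_all _ fun x => sq_nonneg _),
      muV_lintegral hV (by fun_prop)]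
  have hM0 : 0 ≤ ∫ x, |f x| ∂(muV d V) := integral_nonneg fun x => abs_nonneg _
  have hA0 : 0 ≤ ∫ x, f x ^ 2 ∂(muV d V) := integral_nonneg fun x => sq_nonneg _
  have htail := tail_le_jumpEnergy hp hW hfm hr (t := ENNReal.ofReal t) fun x z hx hz1 hz2 => by
    rw [hWdef, ← ENNReal.ofReal_mul ht0, mul_left_comm]
    exact ENNReal.ofReal_le_ofReal (mul_le_mul_of_nonneg_left (ht x z hx hz1 hz2) hc.le)
  have hlocal := local_le_jumpEnergy hp hW hfm (r := r) h0 h1 (κ := ENNReal.ofReal (c * κ))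
    fun z hz => ENNReal.ofReal_le_ofReal (mul_le_mul_of_nonneg_left (hκ z hz) hc.le)
  have hsum := lintegral_add_compl (μ := (volume : Measure (Ed d)))
    (fun x => W x * ENNReal.ofReal (f x ^ 2))
    (measurableSet_lt measurable_const measurable_norm : MeasurableSet {x : Ed d | r < ‖x‖})
  rw [show {x : Ed d | r < ‖x‖}ᶜ = {x | ‖x‖ ≤ r} by ext x; simp, hA] at hsum
  set T := ∫⁻ x in {x | r < ‖x‖}, W x * ENNReal.ofReal (f x ^ 2)
  set L := ∫⁻ x in {x | ‖x‖ ≤ r}, W x * ENNReal.ofReal (f x ^ 2)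
  have hTtop : T ≠ ∞ := fun h => by simp [h] at hsum
  have hLtop : L ≠ ∞ := fun h => by simp [h] at hsum
  have hv (ρ : ℝ) : volume (closedBall (0 : Ed d) ρ) =
      ENNReal.ofReal (volume.real (closedBall (0 : Ed d) ρ)) := by
    rw [ofReal_measureReal measure_closedBall_lt_top.ne]
  refine ⟨T.toReal, L.toReal, ?_, ?_, ?_⟩
  · rw [← ENNReal.toReal_add hTtop hLtop, hsum, ENNReal.toReal_ofReal hA0]
  · rw [hA, hE, hv, hv] at htail
    have := ENNReal.toReal_mono (by finiteness) htail
    rw [ENNReal.toReal_add (by finiteness) (by finiteness)] at this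
    simp only [ENNReal.toReal_mul, ENNReal.toReal_ofNat, ENNReal.toReal_ofReal ht0,
      ENNReal.toReal_ofReal measureReal_nonneg, ENNReal.toReal_ofReal hA0,
      ENNReal.toReal_ofReal (mul_nonneg zero_le_two hE0)] at this
    linarith
  · rw [hM, hE, hv, Measure.addHaar_real_closedBall' _ _ h0, finrank_euclideanSpace_fin] at hlocal
    have := ENNReal.toReal_mono (by finiteness) hlocal
    rw [ENNReal.toReal_add (by finiteness) (by finiteness)] at this
    have hh := Real.rpow_nonneg h0 ((d : ℝ) + α)
    simp only [ENNReal.toReal_mul, ENNReal.toReal_pow, ENNReal.toReal_ofNat,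
      ENNReal.toReal_ofReal (mul_nonneg hc.le hκ0), ENNReal.toReal_ofReal hh,
      ENNReal.toReal_ofReal hM0, ENNReal.toReal_ofReal (mul_nonneg zero_le_two hE0),
      ENNReal.toReal_ofReal (mul_nonneg (pow_nonneg h0 d)
        (measureReal_nonneg (μ := volume) (s := closedBall (0 : Ed d) 1)))] at this
    exact this

lemma infAnn_nonneg (d : ℕ) (V : Ed d → ℝ) (x : Ed d) : 0 ≤ infAnn d V x := by
  refine Real.sInf_nonneg ?_
  rintro _ ⟨z, -, rfl⟩
  positivity

lemma infAnn_le {d : ℕ} (V : Ed d → ℝ) {x z : Ed d} (h1 : ‖x‖ - 1 ≤ ‖z‖)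
    (h2 : ‖z‖ ≤ ‖x‖ - 1 / 2) : infAnn d V x ≤ Real.exp (-V z) := by
  refine csInf_le ⟨0, ?_⟩ ⟨z, ⟨h1, h2⟩, rfl⟩
  rintro _ ⟨z, -, rfl⟩
  positivity

lemma Phi_le {d : ℕ} (V : Ed d → ℝ) {r : ℝ} {x : Ed d} (hx : r ≤ ‖x‖) :
    Phi d V r ≤ Real.exp (V x) * infAnn d V x := by
  refine csInf_le ⟨0, ?_⟩ ⟨x, hx, rfl⟩
  rintro _ ⟨z, -, rfl⟩
  exact mul_nonneg (Real.exp_pos _).le (infAnn_nonneg d V z)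

lemma exists_norm_eq_of_one_le {d : ℕ} (hd : 1 ≤ d) {r : ℝ} (hr : 0 ≤ r) :
    ∃ x : Ed d, ‖x‖ = r := by
  have : Nontrivial (Ed d) := Module.nontrivial_of_finrank_pos (R := ℝ)
    (by simpa using Nat.lt_of_succ_le hd)
  exact _root_.exists_norm_eq (Ed d) hr

lemma le_supAnn {d : ℕ} {V : Ed d → ℝ} (hVloc : LocallyBounded d V) (x : Ed d) :
    Real.exp (-V x) ≤ supAnn d V x := by
  obtain ⟨M, hM⟩ := hVloc (‖x‖ + 1)
  refine le_csSup ⟨Real.exp M, ?_⟩ ⟨x, ⟨le_rfl, by linarith⟩, rfl⟩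
  rintro _ ⟨z, hz, rfl⟩
  exact Real.exp_le_exp.2 (by linarith [neg_abs_le (V z), hM z hz.2])

lemma nonempty_Phi_superlevel {d : ℕ} (hd : 1 ≤ d) {V : Ed d → ℝ} (hVloc : LocallyBounded d V)
    (hliminf : ∀ M : ℝ, ∃ R : ℝ, ∀ x : Ed d, R ≤ ‖x‖ → M ≤ infAnn d V x / supAnn d V x) (t : ℝ) :
    {r : ℝ | 0 < r ∧ t ≤ Phi d V r}.Nonempty := by
  obtain ⟨R, hR⟩ := hliminf t
  refine ⟨max R 1, by positivity, le_csInf ?_ ?_⟩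
  · obtain ⟨x, hx⟩ := exists_norm_eq_of_one_le hd (r := max R 1) (by positivity)
    exact ⟨_, x, hx.ge, rfl⟩
  · rintro _ ⟨x, hx, rfl⟩
    refine (hR x ((le_max_left _ _).trans hx)).trans ?_
    have h1 := le_supAnn hVloc x
    have h2 := Real.exp_pos (-V x)
    rw [div_le_iff₀ (h2.trans_le h1)]
    calc infAnn d V x = Real.exp (V x) * infAnn d V x * Real.exp (-V x) := by
          rw [mul_right_comm, ← Real.exp_add]; simp
      _ ≤ _ := mul_le_mul_of_nonneg_left h1
          (mul_nonneg (Real.exp_pos _).le (infAnn_nonneg d V x))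

lemma le_PhiInv {d : ℕ} {V : Ed d → ℝ} {ρ t : ℝ}
    (hne : {r : ℝ | 0 < r ∧ t ≤ Phi d V r}.Nonempty) (h : ∀ r, 0 < r → r < ρ → Phi d V r < t) :
    ρ ≤ PhiInv d V t := by
  refine le_csInf hne fun r hr => ?_
  by_contra! hlt
  exact (h r hr.1 hlt).not_ge hr.2

lemma Phi_nonpos_of_lt_half {d : ℕ} (hd : 1 ≤ d) (V : Ed d → ℝ) {r : ℝ} (h0 : 0 < r)
    (hr : r < 1 / 2) : Phi d V r ≤ 0 := by
  obtain ⟨x, hx⟩ := exists_norm_eq_of_one_le hd h0.le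
  refine (Phi_le V hx.ge).trans_eq ?_
  have : {z : Ed d | ‖x‖ - 1 ≤ ‖z‖ ∧ ‖z‖ ≤ ‖x‖ - 1 / 2} = ∅ := by
    ext z
    simp only [mem_ofPred_eq, mem_empty_iff_false, iff_false, not_and, not_le]
    intro _
    linarith [norm_nonneg z]
  rw [infAnn, this, image_empty, Real.sInf_empty, mul_zero]

lemma mul_exp_neg_le_of_PhiInv_lt {d : ℕ} {V : Ed d → ℝ} {t : ℝ}
    (hne : {r : ℝ | 0 < r ∧ t ≤ Phi d V r}.Nonempty) {x z : Ed d} (hx : PhiInv d V t < ‖x‖)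
    (h1 : ‖x‖ - 1 ≤ ‖z‖) (h2 : ‖z‖ ≤ ‖x‖ - 1 / 2) :
    t * Real.exp (-V x) ≤ Real.exp (-V z) := by
  obtain ⟨r, hr, hrx⟩ := exists_lt_of_csInf_lt hne hx
  calc t * Real.exp (-V x) ≤ Real.exp (V x) * infAnn d V x * Real.exp (-V x) := by
        gcongr
        exact hr.2.trans (Phi_le V hrx.le)
    _ = infAnn d V x := by rw [mul_right_comm, ← Real.exp_add]; simp
    _ ≤ _ := infAnn_le V h1 h2

lemma kfun_le {d : ℕ} (V : Ed d → ℝ) {r : ℝ} {z : Ed d} (hz : ‖z‖ ≤ r + 1) :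
    kfun d V r ≤ Real.exp (-V z) := by
  refine csInf_le ⟨0, ?_⟩ ⟨z, hz, rfl⟩
  rintro _ ⟨z, -, rfl⟩
  positivity

lemma kfun_pos {d : ℕ} {V : Ed d → ℝ} (hVloc : LocallyBounded d V) {r : ℝ} (hr : 0 ≤ r) :
    0 < kfun d V r := by
  obtain ⟨M, hM⟩ := hVloc (r + 1)
  refine (Real.exp_pos (-M)).trans_le (le_csInf ⟨_, 0, ?_, rfl⟩ ?_)
  · simp only [mem_ofPred_eq, norm_zero]
    linarith
  · rintro _ ⟨z, hz, rfl⟩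
    exact Real.exp_le_exp.2 (by linarith [le_abs_self (V z), hM z hz])

lemma kfun_le_Kfun {d : ℕ} {V : Ed d → ℝ} (hVloc : LocallyBounded d V) {r : ℝ} (hr : 0 ≤ r) :
    kfun d V r ≤ Kfun d V r := by
  obtain ⟨M, hM⟩ := hVloc r
  refine (kfun_le V (z := 0) (by rw [norm_zero]; linarith)).trans
    (le_csSup ⟨Real.exp M, ?_⟩ ⟨0, by simpa using hr, rfl⟩)
  rintro _ ⟨z, hz, rfl⟩
  exact Real.exp_le_exp.2 (by linarith [neg_abs_le (V z), hM z hz])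

lemma inv_kfun_le_rate {d : ℕ} {V : Ed d → ℝ} (hVloc : LocallyBounded d V) {r P a : ℝ}
    (hr : 1 / 2 ≤ r) (hP : 0 ≤ P) (ha : 0 ≤ a) :
    (1 / 2) ^ P * (kfun d V r)⁻¹ ≤
      r ^ P * Kfun d V r ^ (1 + a) * kfun d V r ^ (-(2 + a)) := by
  have hr0 : 0 ≤ r := by linarith
  have hk := kfun_pos hVloc hr0
  have hkK := kfun_le_Kfun hVloc hr0
  calc (1 / 2) ^ P * (kfun d V r)⁻¹
      = (1 / 2) ^ P * kfun d V r ^ (1 + a) * kfun d V r ^ (-(2 + a)) := by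
        rw [mul_assoc, ← Real.rpow_add hk, ← Real.rpow_neg_one]
        congr 2
        ring
    _ ≤ _ := by gcongr

lemma sq_integral_le_of_scale {s α v v₁ c κ E A M T L : ℝ} {d : ℕ} (hs : 0 < s) (hα : 0 < α)
    (hv : 0 < v) (hv₁ : 0 < v₁) (hsv : s * v₁ ≤ 4) (hc : 0 < c) (hκ : 0 < κ) (hA0 : 0 ≤ A)
    (hA : A = T + L) (hT : 16 / v / s * v * T ≤ 4 * E + 2 * v₁ * A)
    (hL : c * κ * (((s * v₁ / 8) ^ (1 / α)) ^ d * v₁) * L ≤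
      c * κ * ((s * v₁ / 8) ^ (1 / α)) ^ ((d : ℝ) + α) * (2 * E) + 2 * M ^ 2) :
    A ≤ s * E + 4 / (c * v₁) * (v₁ / 8) ^ (-((d : ℝ) / α)) * s ^ (-((d : ℝ) / α)) * κ⁻¹ * M ^ 2 := by
  have hb : 0 < s * v₁ / 8 := by positivity
  set h := (s * v₁ / 8) ^ (1 / α) with hh
  have hh0 : 0 < h := by positivity
  have hhα : h ^ α = s * v₁ / 8 := by
    rw [hh, ← Real.rpow_mul hb.le, one_div_mul_cancel hα.ne', Real.rpow_one]
  have hhd : (v₁ / 8) ^ (-((d : ℝ) / α)) * s ^ (-((d : ℝ) / α)) = (h ^ d)⁻¹ := by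
    rw [← Real.mul_rpow (by positivity) hs.le, ← Real.rpow_natCast, ← Real.rpow_neg hh0.le, hh,
      ← Real.rpow_mul hb.le]
    congr 1 <;> ring
  rw [Real.rpow_add hh0, hhα, Real.rpow_natCast] at hL
  have hL' : L ≤ s * E / 4 + 2 / (c * v₁) * (h ^ d)⁻¹ * κ⁻¹ * M ^ 2 := by
    have hpos : 0 < c * κ * (h ^ d * v₁) := by positivity
    rw [← mul_le_mul_iff_right₀ hpos]
    refine hL.trans_eq ?_
    field_simp
    ring
  have hT' : T ≤ s * E / 4 + s * v₁ * A / 8 := by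
    have h1 : 16 / v / s * v * T = 16 / s * T := by field_simp
    rw [h1] at hT
    have hpos : 0 < 16 / s := by positivity
    rw [← mul_le_mul_iff_right₀ hpos]
    refine hT.trans_eq ?_
    field_simp
    ring
  have h3 : s * v₁ * A ≤ 4 * A := mul_le_mul_of_nonneg_right hsv hA0
  rw [mul_assoc (4 / (c * v₁)), hhd]
  have h4 : 4 / (c * v₁) * (h ^ d)⁻¹ * κ⁻¹ * M ^ 2 =
      2 * (2 / (c * v₁) * (h ^ d)⁻¹ * κ⁻¹ * M ^ 2) := by ring
  rw [h4]
  linarith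

lemma volume_real_closedBall_pos {d : ℕ} {ρ : ℝ} (hρ : 0 < ρ) :
    0 < volume.real (closedBall (0 : Ed d) ρ) :=
  ENNReal.toReal_pos (measure_closedBall_pos _ _ hρ).ne' measure_closedBall_lt_top.ne

lemma super_poincare_of_small {d : ℕ} (hd : 1 ≤ d) {α : ℝ} (hα : 0 < α ∧ α < 2)
    {V : Ed d → ℝ} (hV : Measurable V) (hVloc : LocallyBounded d V)
    (hVint : Integrable (fun x => Real.exp (-V x))) {s : ℝ} (hs : 0 < s)
    (hsv : s * volume.real (closedBall (0 : Ed d) 1) ≤ 4)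
    (hne : {r : ℝ | 0 < r ∧
      16 / volume.real (closedBall (0 : Ed d) (1 / 4)) / s ≤ Phi d V r}.Nonempty)
    (hr : 1 ≤ PhiInv d V (16 / volume.real (closedBall (0 : Ed d) (1 / 4)) / s))
    {f : Ed d → ℝ} (hf : CbSmooth d f) :
    ∫ x, f x ^ 2 ∂(muV d V) ≤ s * formE d α V f +
      4 / ((∫ y, Real.exp (-V y))⁻¹ * volume.real (closedBall (0 : Ed d) 1)) *
        (volume.real (closedBall (0 : Ed d) 1) / 8) ^ (-((d : ℝ) / α)) * s ^ (-((d : ℝ) / α)) *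
        (kfun d V (PhiInv d V (16 / volume.real (closedBall (0 : Ed d) (1 / 4)) / s)))⁻¹ *
        (∫ x, |f x| ∂(muV d V)) ^ 2 := by
  have hv : 0 < volume.real (closedBall (0 : Ed d) (1 / 4)) :=
    volume_real_closedBall_pos (by norm_num)
  have hv₁ : 0 < volume.real (closedBall (0 : Ed d) 1) :=
    volume_real_closedBall_pos (by norm_num)
  have hc : 0 < (∫ y, Real.exp (-V y))⁻¹ := inv_pos.2 (integral_exp_pos hVint)
  have hκ := kfun_pos hVloc (zero_le_one.trans hr)
  have hh1 : (s * volume.real (closedBall (0 : Ed d) 1) / 8) ^ (1 / α) ≤ 1 :=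
    Real.rpow_le_one (by positivity) (by linarith) (one_div_nonneg.2 hα.1.le)
  obtain ⟨T, L, hA, hT, hL⟩ := exists_tail_local_decomposition hd hα hV hVint hf hr
    (by positivity) (fun x z hx h1 h2 => mul_exp_neg_le_of_PhiInv_lt hne hx h1 h2) hκ.le
    (fun z hz => kfun_le V hz) (by positivity) hh1
  exact sq_integral_le_of_scale hs hα.1 hv hv₁ hsv hc hκ
    (integral_nonneg fun x => sq_nonneg _) hA hT hL

/-- super Poincaré inequality for the finite-range-jump Dirichlet form
when the liminf is infinite, with explicit rate function. -/
theorem super_poincare_finite_range_jump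
    (d : ℕ) (hd : 1 ≤ d) (α : ℝ) (hα : 0 < α ∧ α < 2)
    (V : Ed d → ℝ) (hVmeas : Measurable V) (hVloc : LocallyBounded d V)
    (hVint : Integrable (fun x => Real.exp (-V x)))
    (hliminf : ∀ M : ℝ, ∃ R : ℝ, ∀ x : Ed d, R ≤ ‖x‖ →
      M ≤ infAnn d V x / supAnn d V x) :
    ∃ C₂ C₃ : ℝ, 0 < C₂ ∧ 0 < C₃ ∧ ∀ s : ℝ, 0 < s → ∀ f : Ed d → ℝ, CbSmooth d f →
      ∫ x, (f x) ^ 2 ∂(muV d V) ≤ s * formE d α V f +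
        (C₂ * (1 + s ^ (-((d:ℝ)/α))) *
          PhiInv d V (C₃ / s) ^ ((d:ℝ) + (d:ℝ)^2/α) *
          Kfun d V (PhiInv d V (C₃ / s)) ^ (1 + (d:ℝ)/α) *
          kfun d V (PhiInv d V (C₃ / s)) ^ (-(2 + (d:ℝ)/α))) *
        (∫ x, |f x| ∂(muV d V)) ^ 2 := by

  have hv : 0 < volume.real (closedBall (0 : Ed d) (1 / 4)) :=
    volume_real_closedBall_pos (by norm_num)
  have hv₁ : 0 < volume.real (closedBall (0 : Ed d) 1) :=
    volume_real_closedBall_pos (by norm_num)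
  have hc : 0 < (∫ y, Real.exp (-V y))⁻¹ := inv_pos.2 (integral_exp_pos hVint)
  have hne := nonempty_Phi_superlevel hd hVloc hliminf
  have hsmall := fun (s : ℝ) (hs : 0 < s) hsv hr f (hf : CbSmooth d f) =>
    super_poincare_of_small hd hα hVmeas hVloc hVint hs hsv (hne _) hr hf
  obtain ⟨e, he⟩ := exists_norm_eq_of_one_le hd zero_le_one
  set v := volume.real (closedBall (0 : Ed d) (1 / 4))
  set v₁ := volume.real (closedBall (0 : Ed d) 1)
  set c := (∫ y, Real.exp (-V y))⁻¹
  set a := (d : ℝ) / α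
  have ha0 : 0 ≤ a := div_nonneg (Nat.cast_nonneg d) hα.1.le
  set P := (d : ℝ) + (d : ℝ) ^ 2 / α
  have hP0 : 0 ≤ P := add_nonneg (Nat.cast_nonneg d) (div_nonneg (by positivity) hα.1.le)
  set τ := Real.exp (V e) * Real.exp (-V 0)
  have hτ0 : 0 < τ := by positivity
  set s₀ := min (4 / v₁) (16 / v / (τ + 1))
  have hs₀0 : 0 < s₀ := by positivity
  have hr1 : ∀ s, 0 < s → s ≤ s₀ → 1 ≤ PhiInv d V (16 / v / s) := by
    intro s hs hss
    refine le_PhiInv (hne _) fun r _ hr => ?_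
    have h1 : τ < 16 / v / s := by
      have := hss.trans (min_le_right _ _)
      rw [le_div_comm₀ hs (by positivity)] at this
      linarith
    refine lt_of_le_of_lt (Phi_le V (hr.le.trans_eq he.symm)) (lt_of_le_of_lt ?_ h1)
    exact mul_le_mul_of_nonneg_left
      (infAnn_le V (by simp [he]) (by rw [norm_zero, he]; norm_num)) (Real.exp_pos _).le
  have hsv : ∀ s, s ≤ s₀ → s * v₁ ≤ 4 := fun s hss =>
    (le_div_iff₀ hv₁).1 (hss.trans (min_le_left _ _))
  have hhalf : ∀ s, 0 < s → 1 / 2 ≤ PhiInv d V (16 / v / s) := fun s hs =>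
    le_PhiInv (hne _) fun r h0 hr => (Phi_nonpos_of_lt_half hd V h0 hr).trans_lt (by positivity)
  set D₁ := 4 / (c * v₁) * (v₁ / 8) ^ (-a)
  have hD₁ : 0 < D₁ := by positivity
  set k₀ := kfun d V (PhiInv d V (16 / v / s₀))
  have hk₀ : 0 < k₀ := kfun_pos hVloc (zero_le_one.trans (hr1 s₀ hs₀0 le_rfl))
  set D₂ := D₁ * s₀ ^ (-a) * k₀⁻¹
  have hD₂ : 0 < D₂ := by positivity
  have hq : (0 : ℝ) < (1 / 2) ^ P := by positivity
  refine ⟨(D₁ + D₂ * Real.exp (-V 0)) / (1 / 2) ^ P, 16 / v, by positivity, by positivity,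
    fun s hs f hf => ?_⟩
  set r := PhiInv d V (16 / v / s)
  have hr := hhalf s hs
  have hrate := inv_kfun_le_rate hVloc hr hP0 ha0
  have hk : 0 < kfun d V r := kfun_pos hVloc (by linarith)
  have hsa : 0 < s ^ (-a) := by positivity
  have hβ : (D₁ + D₂ * Real.exp (-V 0)) * (1 + s ^ (-a)) * (kfun d V r)⁻¹ ≤
      (D₁ + D₂ * Real.exp (-V 0)) / (1 / 2) ^ P * (1 + s ^ (-a)) * r ^ P *
        Kfun d V r ^ (1 + a) * kfun d V r ^ (-(2 + a)) := by
    calc _ = (D₁ + D₂ * Real.exp (-V 0)) / (1 / 2) ^ P * (1 + s ^ (-a)) *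
          ((1 / 2) ^ P * (kfun d V r)⁻¹) := by field_simp
      _ ≤ (D₁ + D₂ * Real.exp (-V 0)) / (1 / 2) ^ P * (1 + s ^ (-a)) *
          (r ^ P * Kfun d V r ^ (1 + a) * kfun d V r ^ (-(2 + a))) := by gcongr
      _ = _ := by ring
  suffices h : ∫ x, f x ^ 2 ∂(muV d V) ≤ s * formE d α V f +
      (D₁ + D₂ * Real.exp (-V 0)) * (1 + s ^ (-a)) * (kfun d V r)⁻¹ *
        (∫ x, |f x| ∂(muV d V)) ^ 2 from h.trans (by gcongr)
  have hw : 0 < Real.exp (-V 0) := Real.exp_pos _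
  rcases le_total s s₀ with hss | hss
  · refine (hsmall s hs (hsv s hss) (hr1 s hs hss) f hf).trans ?_
    gcongr _ + ?_ * _ * _
    nlinarith [mul_pos hD₂ hw, mul_pos (mul_pos hD₂ hw) hsa]
  · refine (hsmall s₀ hs₀0 (hsv s₀ le_rfl) (hr1 s₀ hs₀0 le_rfl) f hf).trans ?_
    gcongr ?_ + ?_ * _
    · exact mul_le_mul_of_nonneg_right hss (formE_nonneg α V f)
    · have hkw : kfun d V r ≤ Real.exp (-V 0) := kfun_le V (by rw [norm_zero]; linarith)
      have h1 : 1 ≤ Real.exp (-V 0) * (kfun d V r)⁻¹ := by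
        rwa [← div_eq_mul_inv, one_le_div hk]
      calc D₂ ≤ D₂ * (Real.exp (-V 0) * (kfun d V r)⁻¹) := le_mul_of_one_le_right hD₂.le h1
        _ = (D₂ * Real.exp (-V 0)) * 1 * (kfun d V r)⁻¹ := by ring
        _ ≤ _ := by
          gcongr
          · linarith
          · linarith
end
end

section
/- Let δ > 0 and μ_{V_δ}(dx) = C_δ e^{−(1+|x|^δ)} dx (i.e. V_δ(x) = 1 + |x|^δ). (i) If 0 < δ ≤ 1, then the super Poincaré inequality μ_{V_δ}(f²) ≤ s · 𝓔_{α,V_δ}(f,f) + β(s) · μ_{V_δ}(|f|)² (for all s > 0 and f ∈ C_b^∞(ℝ^d)) fails for every decreasing rate function β : (0,∞) → (0,∞). (ii) If δ > 1, then the super Poincaré inequality does not hold with any decreasing rate function β satisfying lim_{s→0} log β(s) / log^{δ/(δ−1)}(1 + s^{−1}) = 0. -/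
open MeasureTheory Real Set Metric Filter

noncomputable section

/-- `V_δ(x) = 1 + |x|^δ`. -/
def Vdelta (d : ℕ) (δ : ℝ) : Ed d → ℝ := fun x => 1 + ‖x‖ ^ δ

theorem integrable_exp_neg_Vdelta {d : ℕ} (hd : 1 ≤ d) {δ : ℝ} (hδ : 0 < δ) :
    Integrable (fun x : Ed d => exp (-Vdelta d δ x)) := by
  have : Nontrivial (Ed d) := Module.nontrivial_of_finrank_pos (R := ℝ) (by simpa using Nat.pos_of_ne_zero (by omega))
  refine (integrable_fun_norm_addHaar (E := Ed d) volume
    (f := fun t : ℝ => exp (-(1 + t ^ δ)))).2 ?_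
  have hs : (-1 : ℝ) < ((d - 1 : ℕ) : ℝ) := by linarith [Nat.cast_nonneg (α := ℝ) (d - 1)]
  have h : IntegrableOn (fun t : ℝ => exp (-1) * (t ^ ((d - 1 : ℕ) : ℝ) * exp (-t ^ δ))) (Ioi 0) :=
    (integrableOn_rpow_mul_exp_neg_rpow hs hδ).const_mul (exp (-1))
  refine IntegrableOn.congr_fun h (fun t _ => ?_) measurableSet_Ioi
  simp only [finrank_euclideanSpace, Fintype.card_fin, smul_eq_mul, rpow_natCast, neg_add, exp_add]
  ring

theorem integral_exp_neg_Vdelta_pos {d : ℕ} (hd : 1 ≤ d) {δ : ℝ} (hδ : 0 < δ) :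
    0 < ∫ x : Ed d, exp (-Vdelta d δ x) :=
  integral_exp_pos (integrable_exp_neg_Vdelta hd hδ)

theorem muV_apply (d : ℕ) (V : Ed d → ℝ) (A : Set (Ed d)) :
    muV d V A = ∫⁻ x in A, ENNReal.ofReal ((∫ y, exp (-V y))⁻¹ * exp (-V x)) :=
  withDensity_apply' _ A

theorem muV_le {d : ℕ} {V : Ed d → ℝ} {A : Set (Ed d)} (hA : MeasurableSet A) {M : ℝ}
    (h : ∀ x ∈ A, (∫ y, exp (-V y))⁻¹ * exp (-V x) ≤ M) :
    muV d V A ≤ ENNReal.ofReal M * volume A := by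
  rw [muV_apply, ← setLIntegral_const]
  exact setLIntegral_mono' hA fun x hx => ENNReal.ofReal_le_ofReal (h x hx)

theorem le_muV {d : ℕ} {V : Ed d → ℝ} {A : Set (Ed d)} (hA : MeasurableSet A) {M : ℝ}
    (h : ∀ x ∈ A, M ≤ (∫ y, exp (-V y))⁻¹ * exp (-V x)) :
    ENNReal.ofReal M * volume A ≤ muV d V A := by
  rw [muV_apply, ← setLIntegral_const]
  exact setLIntegral_mono' hA fun x hx => ENNReal.ofReal_le_ofReal (h x hx)

theorem Vdelta_le_of_mem_closedBall {d : ℕ} {δ : ℝ} (hδ : 0 < δ) {z x : Ed d} {r : ℝ}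
    (hx : x ∈ closedBall z r) : Vdelta d δ x ≤ 1 + (‖z‖ + r) ^ δ := by
  have h : ‖x‖ ≤ ‖z‖ + r := by
    have := norm_le_norm_add_norm_sub' x z
    have := mem_closedBall_iff_norm.1 hx
    linarith
  unfold Vdelta
  gcongr

theorem le_Vdelta_of_mem_closedBall {d : ℕ} {δ : ℝ} (hδ : 0 < δ) {z x : Ed d} {r : ℝ}
    (hr : r ≤ ‖z‖) (hx : x ∈ closedBall z r) : 1 + (‖z‖ - r) ^ δ ≤ Vdelta d δ x := by
  have h : ‖z‖ - r ≤ ‖x‖ := by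
    have := norm_le_norm_add_norm_sub x z
    have := mem_closedBall_iff_norm.1 hx
    linarith
  have h0 : 0 ≤ ‖z‖ - r := sub_nonneg.2 hr
  unfold Vdelta
  gcongr

/-- Upper bound for the mass that `μ_{V_δ}` gives to a ball. -/
theorem muV_Vdelta_closedBall_le {d : ℕ} (hd : 1 ≤ d) {δ : ℝ} (hδ : 0 < δ) {z : Ed d} {r : ℝ}
    (hr : r ≤ ‖z‖) :
    muV d (Vdelta d δ) (closedBall z r) < ⊤ ∧
    (muV d (Vdelta d δ)).real (closedBall z r) ≤
      (∫ y, exp (-Vdelta d δ y))⁻¹ * exp (-(1 + (‖z‖ - r) ^ δ)) *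
        volume.real (closedBall (0 : Ed d) r) := by
  have hZ := integral_exp_neg_Vdelta_pos hd hδ
  have hfin : volume (closedBall z r) < ⊤ := measure_closedBall_lt_top
  have key := muV_le (d := d) (V := Vdelta d δ) (A := closedBall z r) measurableSet_closedBall
    (M := (∫ y, exp (-Vdelta d δ y))⁻¹ * exp (-(1 + (‖z‖ - r) ^ δ))) (fun x hx => by
      have := le_Vdelta_of_mem_closedBall hδ hr hx
      gcongr)
  refine ⟨key.trans_lt (ENNReal.mul_lt_top ENNReal.ofReal_lt_top hfin), ?_⟩
  have h := ENNReal.toReal_mono (ENNReal.mul_ne_top ENNReal.ofReal_ne_top hfin.ne) key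
  rw [ENNReal.toReal_mul, ENNReal.toReal_ofReal (by positivity),
    Measure.addHaar_closedBall_center (volume : Measure (Ed d))] at h
  exact h

/-- Lower bound for the mass that `μ_{V_δ}` gives to a ball. -/
theorem le_muV_Vdelta_closedBall {d : ℕ} (hd : 1 ≤ d) {δ : ℝ} (hδ : 0 < δ) {z : Ed d} {r : ℝ}
    (hr : r ≤ ‖z‖) :
    (∫ y, exp (-Vdelta d δ y))⁻¹ * exp (-(1 + (‖z‖ + r) ^ δ)) *
        volume.real (closedBall (0 : Ed d) r) ≤ (muV d (Vdelta d δ)).real (closedBall z r) := by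
  have hZ := integral_exp_neg_Vdelta_pos hd hδ
  have key := le_muV (d := d) (V := Vdelta d δ) (A := closedBall z r) measurableSet_closedBall
    (M := (∫ y, exp (-Vdelta d δ y))⁻¹ * exp (-(1 + (‖z‖ + r) ^ δ))) (fun x hx => by
      have := Vdelta_le_of_mem_closedBall hδ hx
      gcongr)
  have h := ENNReal.toReal_mono (muV_Vdelta_closedBall_le hd hδ hr).1.ne key
  rw [ENNReal.toReal_mul, ENNReal.toReal_ofReal (by positivity),
    Measure.addHaar_closedBall_center (volume : Measure (Ed d))] at h
  exact h

theorem integrableOn_norm_rpow_closedBall {d : ℕ} (hd : 1 ≤ d) {a : ℝ} (ha : -(d : ℝ) < a)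
    (r : ℝ) : IntegrableOn (fun u : Ed d => ‖u‖ ^ a) (closedBall 0 r) := by
  have hm : Measurable fun u : Ed d => ‖u‖ ^ a := by fun_prop
  refine (integrableOn_ball_of_norm_le_rpow (E := Ed d) (μ := volume) (C := 1) (α := -a)
    (r := r + 1) (by simpa using hd) (by simpa using by linarith) (ae_of_all _ fun x => ?_)
    hm.aestronglyMeasurable).mono_set (closedBall_subset_ball (by linarith))
  rw [norm_of_nonneg (by positivity), neg_neg, one_mul]

theorem sq_sub_div_dist_rpow_le {d : ℕ} {f : Ed d → ℝ} {K : NNReal} (hf : LipschitzWith K f)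
    (b : ℝ) (x y : Ed d) :
    (f x - f y) ^ 2 / dist x y ^ b ≤ (K : ℝ) ^ 2 * ‖x - y‖ ^ (2 - b) := by
  rcases eq_or_ne x y with rfl | hxy
  · simp only [sub_self, ne_eq, OfNat.ofNat_ne_zero, not_false_eq_true, zero_pow, zero_div]
    positivity
  have hd : 0 < dist x y := dist_pos.2 hxy
  have h := hf.dist_le_mul x y
  rw [Real.dist_eq] at h
  have h2 : (f x - f y) ^ 2 ≤ (K * dist x y) ^ 2 := by
    rw [← sq_abs]
    gcongr
  rw [← dist_eq_norm, rpow_sub hd, rpow_two, ← mul_div_assoc, ← mul_pow]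
  gcongr

/-- The energy of a Lipschitz function supported in a unit ball is controlled by the mass of the
concentric ball of radius two. -/
theorem formE_le_of_lipschitzWith {d : ℕ} (hd : 1 ≤ d) {α : ℝ} (hα : α < 2) {V f : Ed d → ℝ}
    {K : NNReal} (hf : LipschitzWith K f) {z : Ed d} (hsupp : ∀ x, 1 ≤ dist x z → f x = 0)
    (hfin : muV d V (closedBall z 2) < ⊤) :
    formE d α V f ≤ (1 / 2 * ((K : ℝ) ^ 2 *
      ∫ u in closedBall (0 : Ed d) 1, ‖u‖ ^ (2 - (d + α)))) * (muV d V).real (closedBall z 2) := by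
  set g : Ed d → ℝ := fun u => (K : ℝ) ^ 2 * ‖u‖ ^ (2 - (d + α))
  have hgint : IntegrableOn g (closedBall 0 1) :=
    (integrableOn_norm_rpow_closedBall hd (by linarith) 1).const_mul _
  have hI : (K : ℝ) ^ 2 * ∫ u in closedBall (0 : Ed d) 1, ‖u‖ ^ (2 - (d + α))
      = ∫ u in closedBall (0 : Ed d) 1, g u := (integral_const_mul _ _).symm
  rw [hI]
  set I := ∫ u in closedBall (0 : Ed d) 1, g u
  have hinner : ∀ x : Ed d, ∫ y in {y : Ed d | dist x y ≤ 1},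
      (f x - f y) ^ 2 / dist x y ^ ((d : ℝ) + α) ≤ I := by
    intro x
    have hset : {y : Ed d | dist x y ≤ 1} = closedBall x 1 := by
      ext y
      simp [dist_comm]
    have hind : ∀ y, (closedBall (0 : Ed d) 1).indicator g (x - y)
        = (closedBall x 1).indicator (fun y => g (x - y)) y := by
      intro y
      by_cases hy : y ∈ closedBall x 1
      · rw [indicator_of_mem hy, indicator_of_mem]
        simpa [dist_eq_norm, norm_sub_rev] using hy
      · rw [indicator_of_notMem hy, indicator_of_notMem]
        simpa [dist_eq_norm, norm_sub_rev] using hy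
    have hint : IntegrableOn (fun y => g (x - y)) (closedBall x 1) := by
      rw [← integrable_indicator_iff measurableSet_closedBall]
      have := ((integrable_indicator_iff measurableSet_closedBall).2 hgint).comp_sub_left x
      exact this.congr (ae_of_all _ hind)
    have hval : ∫ y in closedBall x 1, g (x - y) = I := by
      rw [← integral_indicator measurableSet_closedBall, ← integral_congr_ae (ae_of_all _ hind),
        integral_sub_left_eq_self _ volume x, integral_indicator measurableSet_closedBall]
    rw [hset, ← hval]
    exact integral_mono_of_nonneg (ae_of_all _ fun y => by positivity) hint
      (ae_of_all _ fun y => sq_sub_div_dist_rpow_le hf _ x y)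
  have houter : ∀ x : Ed d, ∫ y in {y : Ed d | dist x y ≤ 1},
      (f x - f y) ^ 2 / dist x y ^ ((d : ℝ) + α) ≤ (closedBall z 2).indicator (fun _ => I) x := by
    intro x
    by_cases hx : x ∈ closedBall z 2
    · rw [indicator_of_mem hx]
      exact hinner x
    rw [indicator_of_notMem hx]
    rw [mem_closedBall, not_le] at hx
    refine (setIntegral_eq_zero_of_forall_eq_zero fun y hy => ?_).le
    have h1 : f x = 0 := hsupp x (by linarith)
    have h2 : f y = 0 := hsupp y (by
      have := dist_triangle x y z
      have : dist x y ≤ 1 := hy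
      linarith)
    simp [h1, h2]
  unfold formE
  rw [mul_assoc]
  gcongr
  calc _ ≤ ∫ x, (closedBall z 2).indicator (fun _ => I) x ∂(muV d V) :=
        integral_mono_of_nonneg (ae_of_all _ fun x => integral_nonneg fun y => by positivity)
          ((integrable_indicator_iff measurableSet_closedBall).2
            (integrableOn_const hfin.ne)) (ae_of_all _ houter)
    _ = _ := by
        rw [integral_indicator measurableSet_closedBall, setIntegral_const, smul_eq_mul, mul_comm]

/-- Translates of a compactly supported smooth function lie in `C_b^∞`. -/
theorem cbSmooth_comp_sub {d : ℕ} {g : Ed d → ℝ} (hg : ContDiff ℝ (⊤ : ℕ∞) g)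
    (hc : HasCompactSupport g) (z : Ed d) : CbSmooth d (fun x => g (x - z)) := by
  refine ⟨hg.comp (contDiff_id.sub contDiff_const), fun n => ?_⟩
  obtain ⟨C, hC⟩ := (hc.iteratedFDeriv (𝕜 := ℝ) n).exists_bound_of_continuous
    (hg.continuous_iteratedFDeriv (by exact_mod_cast le_top))
  refine ⟨C, fun x => ?_⟩
  have := iteratedFDeriv_comp_add_right (𝕜 := ℝ) (f := g) n (-z) x
  simp only [← sub_eq_add_neg] at this
  rw [this]
  exact hC _

/-- Testing the super Poincaré inequality with a bump at distance `N - 1` from the origin. -/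
theorem super_poincare_Vdelta_bump {d : ℕ} (hd : 1 ≤ d) {α : ℝ} (hα : α < 2) {δ : ℝ}
    (hδ : 0 < δ) :
    ∃ c C : ℝ, 0 < c ∧ 0 < C ∧ ∀ β : ℝ → ℝ, (∀ s, 0 < s → 0 < β s) →
      (∀ s : ℝ, 0 < s → ∀ f : Ed d → ℝ, CbSmooth d f →
        ∫ x, (f x) ^ 2 ∂(muV d (Vdelta d δ)) ≤ s * formE d α (Vdelta d δ) f +
          β s * (∫ x, |f x| ∂(muV d (Vdelta d δ))) ^ 2) →
      ∀ s, 0 < s → ∀ N : ℝ, 3 ≤ N →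
        c * exp (-N ^ δ) ≤
          s * (C * exp (-(N - 3) ^ δ)) + β s * (C * exp (-(2 * (N - 2) ^ δ))) := by
  let φ : ContDiffBump (0 : Ed d) := ⟨1 / 2, 1, by norm_num, by norm_num⟩
  have hφs : ContDiff ℝ (⊤ : ℕ∞) φ := φ.contDiff
  obtain ⟨K, hK⟩ := ContDiff.lipschitzWith_of_hasCompactSupport (𝕂 := ℝ) φ.hasCompactSupport hφs
    (by simp)
  set Z := (∫ y, exp (-Vdelta d δ y))⁻¹
  have hZ : 0 < Z := inv_pos.2 (integral_exp_neg_Vdelta_pos hd hδ)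
  set w : ℝ → ℝ := fun r => volume.real (closedBall (0 : Ed d) r)
  have hwpos : ∀ r, 0 < r → 0 < w r := fun r hr =>
    ENNReal.toReal_pos (measure_closedBall_pos _ _ hr).ne' measure_closedBall_lt_top.ne
  set J := 1 / 2 * ((K : ℝ) ^ 2 * ∫ u in closedBall (0 : Ed d) 1, ‖u‖ ^ (2 - (d + α)))
  have hJ0 : 0 ≤ J := by
    have : 0 ≤ ∫ u in closedBall (0 : Ed d) 1, ‖u‖ ^ (2 - (d + α)) :=
      integral_nonneg fun u => by positivity
    positivity
  have hw1 := hwpos 1 one_pos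
  have hw2 := hwpos 2 two_pos
  have hwh := hwpos (1 / 2) (by norm_num)
  refine ⟨Z * exp (-1) * w (1 / 2), J * (Z * exp (-1) * w 2) + (Z * exp (-1) * w 1) ^ 2,
    by positivity, by positivity, ?_⟩
  intro β hβ hSP s hs N hN
  have hne : Nontrivial (Ed d) := Module.nontrivial_of_finrank_pos (R := ℝ) (by simpa using Nat.pos_of_ne_zero (by omega))
  obtain ⟨z, hz⟩ : ∃ z : Ed d, ‖z‖ = N - 1 := exists_norm_eq (Ed d) (by linarith)
  have hfin2 := (muV_Vdelta_closedBall_le hd hδ (z := z) (r := 2) (by linarith))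
  have hfin1 := (muV_Vdelta_closedBall_le hd hδ (z := z) (r := 1) (by linarith))
  have hlow := (le_muV_Vdelta_closedBall hd hδ (z := z) (r := 1 / 2) (by linarith))
  set μ := muV d (Vdelta d δ)
  set f : Ed d → ℝ := fun x => φ (x - z) with hf
  have hflip : LipschitzWith K f := by
    refine LipschitzWith.of_dist_le_mul fun x y => ?_
    simpa [hf] using hK.dist_le_mul (x - z) (y - z)
  have hfsupp : ∀ x, 1 ≤ dist x z → f x = 0 := fun x hx =>
    φ.zero_of_le_dist (by simpa [dist_eq_norm] using hx)
  have hE := formE_le_of_lipschitzWith hd hα hflip hfsupp hfin2.1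
  have hmain := hSP s hs f (cbSmooth_comp_sub hφs φ.hasCompactSupport z)
  have hfle : ∀ x, |f x| ≤ (closedBall z 1).indicator (fun _ => (1 : ℝ)) x := by
    intro x
    by_cases hx : x ∈ closedBall z 1
    · rw [indicator_of_mem hx, abs_of_nonneg φ.nonneg]
      exact φ.le_one
    · rw [indicator_of_notMem hx, hfsupp x (by
        rw [mem_closedBall, not_le] at hx
        exact hx.le)]
      simp
  have hind1 : Integrable ((closedBall z 1).indicator (fun _ => (1 : ℝ))) μ :=
    (integrable_indicator_iff measurableSet_closedBall).2 (integrableOn_const hfin1.1.ne)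
  have hL1 : ∫ x, |f x| ∂μ ≤ μ.real (closedBall z 1) := by
    calc _ ≤ ∫ x, (closedBall z 1).indicator (fun _ => (1 : ℝ)) x ∂μ :=
          integral_mono_of_nonneg (ae_of_all _ fun x => abs_nonneg _) hind1 (ae_of_all _ hfle)
      _ = _ := by
          rw [integral_indicator measurableSet_closedBall, setIntegral_const, smul_eq_mul, mul_one]
  have hfcont : Continuous f := φ.continuous.comp (continuous_id.sub continuous_const)
  have hL2 : μ.real (closedBall z (1 / 2)) ≤ ∫ x, (f x) ^ 2 ∂μ := by
    calc _ = ∫ x, (closedBall z (1 / 2)).indicator (fun _ => (1 : ℝ)) x ∂μ := by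
          rw [integral_indicator measurableSet_closedBall, setIntegral_const, smul_eq_mul, mul_one]
      _ ≤ _ := by
          refine integral_mono_of_nonneg (ae_of_all _ fun x => ?_) ?_ (ae_of_all _ fun x => ?_)
          · exact indicator_nonneg (fun _ _ => zero_le_one) x
          · refine hind1.mono' (hfcont.pow 2).aestronglyMeasurable (ae_of_all _ fun x => ?_)
            refine le_trans ?_ (hfle x)
            rw [norm_pow, Real.norm_eq_abs]
            refine pow_le_of_le_one (abs_nonneg _) ?_ two_ne_zero
            rw [abs_of_nonneg φ.nonneg]
            exact φ.le_one
          · by_cases hx : x ∈ closedBall z (1 / 2)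
            · have : f x = 1 := φ.one_of_mem_closedBall (by
                rw [mem_closedBall_iff_norm, sub_zero]
                exact mem_closedBall_iff_norm.1 hx)
              exact (indicator_of_mem hx _).trans_le (by simp [this])
            · rw [indicator_of_notMem hx]
              positivity
  have hβs := hβ s hs
  have hexpN : exp (-N ^ δ) ≤ exp (-(‖z‖ + 1 / 2) ^ δ) := by
    rw [hz]
    have : N - 1 + 1 / 2 ≤ N := by linarith
    have h0 : 0 ≤ N - 1 + 1 / 2 := by linarith
    gcongr
  have e2 : ‖z‖ - 2 = N - 3 := by rw [hz]; ring
  have e1 : ‖z‖ - 1 = N - 2 := by rw [hz]; ring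
  have hu2 := hfin2.2
  have hu1 := hfin1.2
  rw [e2] at hu2
  rw [e1] at hu1
  simp only [neg_add, exp_add] at hu2 hu1 hlow
  have hL1' : (∫ x, |f x| ∂μ) ^ 2 ≤ (Z * exp (-1) * w 1) ^ 2 * exp (-(2 * (N - 2) ^ δ)) := by
    have h0 : 0 ≤ ∫ x, |f x| ∂μ := integral_nonneg fun x => abs_nonneg _
    calc _ ≤ (Z * (exp (-1) * exp (-(N - 2) ^ δ)) * w 1) ^ 2 := by
          gcongr
          exact hL1.trans hu1
      _ = _ := by
          have : exp (-(2 * (N - 2) ^ δ)) = exp (-(N - 2) ^ δ) ^ 2 := by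
            rw [← exp_nat_mul]
            congr 1
            push_cast
            ring
          rw [this]
          ring
  have hE' : formE d α (Vdelta d δ) f ≤ J * (Z * exp (-1) * w 2) * exp (-(N - 3) ^ δ) := by
    calc _ ≤ J * (Z * (exp (-1) * exp (-(N - 3) ^ δ)) * w 2) :=
          hE.trans (mul_le_mul_of_nonneg_left hu2 hJ0)
      _ = _ := by ring
  have hJw : 0 ≤ J * (Z * exp (-1) * w 2) := mul_nonneg hJ0 (by positivity)
  calc Z * exp (-1) * w (1 / 2) * exp (-N ^ δ)
      ≤ Z * exp (-1) * w (1 / 2) * exp (-(‖z‖ + 1 / 2) ^ δ) := by gcongr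
    _ = Z * (exp (-1) * exp (-(‖z‖ + 1 / 2) ^ δ)) * w (1 / 2) := by ring
    _ ≤ s * formE d α (Vdelta d δ) f + β s * (∫ x, |f x| ∂μ) ^ 2 := (hlow.trans hL2).trans hmain
    _ ≤ _ := by
        refine add_le_add (mul_le_mul_of_nonneg_left (hE'.trans ?_) hs.le)
          (mul_le_mul_of_nonneg_left (hL1'.trans ?_) hβs.le)
        · exact mul_le_mul_of_nonneg_right (le_add_of_nonneg_right (sq_nonneg _)) (exp_nonneg _)
        · exact mul_le_mul_of_nonneg_right (le_add_of_nonneg_left hJw) (exp_nonneg _)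

theorem rpow_sub_le_of_le_one {δ : ℝ} (hδ : 0 < δ) (hδ1 : δ ≤ 1) {N a : ℝ} (ha : 0 ≤ a)
    (haN : a ≤ N) : N ^ δ - (N - a) ^ δ ≤ a ^ δ := by
  have := Real.rpow_add_le_add_rpow (sub_nonneg.2 haN) ha hδ.le hδ1
  rw [sub_add_cancel] at this
  linarith

theorem rpow_sub_le_of_one_le {δ : ℝ} (hδ : 1 ≤ δ) {N a : ℝ} (hN : 0 < N)
    (haN : a ≤ N) : N ^ δ - (N - a) ^ δ ≤ a * δ * N ^ (δ - 1) := by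
  have h1 : -1 ≤ -(a / N) := neg_le_neg ((div_le_one hN).2 haN)
  have h := one_add_mul_self_le_rpow_one_add h1 hδ
  have h2 : N - a = N * (1 + -(a / N)) := by
    field_simp
    ring
  rw [h2, mul_rpow hN.le (by linarith), rpow_sub_one hN.ne']
  have := mul_le_mul_of_nonneg_left h (rpow_nonneg hN.le δ)
  have e : N ^ δ * (1 + δ * -(a / N)) = N ^ δ - a * δ * (N ^ δ / N) := by
    field_simp
    ring
  linarith

/-- A super Poincaré inequality for `μ_{V_δ}` forces a lower bound on its rate function. -/
theorem le_log_rate_of_super_poincare {d : ℕ} (hd : 1 ≤ d) {α : ℝ} (hα : α < 2) {δ : ℝ}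
    (hδ : 0 < δ) :
    ∃ κ : ℝ, 0 < κ ∧ ∀ β : ℝ → ℝ, (∀ s, 0 < s → 0 < β s) →
      (∀ s : ℝ, 0 < s → ∀ f : Ed d → ℝ, CbSmooth d f →
        ∫ x, (f x) ^ 2 ∂(muV d (Vdelta d δ)) ≤ s * formE d α (Vdelta d δ) f +
          β s * (∫ x, |f x| ∂(muV d (Vdelta d δ))) ^ 2) →
      ∀ N D : ℝ, 3 ≤ N → N ^ δ - (N - 3) ^ δ ≤ D →
        N ^ δ - 2 * D + log κ ≤ log (β (κ * exp (-D))) := by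
  obtain ⟨c, C, hc, hC, hmain⟩ := super_poincare_Vdelta_bump (d := d) hd hα hδ
  refine ⟨c / (2 * C), by positivity, fun β hβ hSP N D hN hD => ?_⟩
  set κ := c / (2 * C) with hκ
  have hκ0 : 0 < κ := by positivity
  have hs : 0 < κ * exp (-D) := by positivity
  have h := hmain β hβ hSP _ hs N hN
  have hb := hβ _ hs
  set b := β (κ * exp (-D))
  have h23 : (N - 3) ^ δ ≤ (N - 2) ^ δ :=
    rpow_le_rpow (by linarith) (by linarith) hδ.le
  have hcκ : c = 2 * (κ * C) := by
    rw [hκ]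
    field_simp
  have e1 : exp (-(N - 3) ^ δ) ≤ exp (D - N ^ δ) := exp_le_exp.2 (by linarith)
  have e2 : exp (-(2 * (N - 2) ^ δ)) ≤ exp (2 * D - 2 * N ^ δ) := exp_le_exp.2 (by linarith)
  have h1 : 2 * (κ * C) * exp (-N ^ δ) ≤
      κ * exp (-D) * (C * exp (D - N ^ δ)) + b * (C * exp (2 * D - 2 * N ^ δ)) := by
    rw [← hcκ]
    refine h.trans ?_
    gcongr
  have h2 : exp (-D) * exp (D - N ^ δ) = exp (-N ^ δ) := by
    rw [← exp_add]
    ring_nf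
  have h3 : exp (2 * D - 2 * N ^ δ) = exp (2 * D - N ^ δ) * exp (-N ^ δ) := by
    rw [← exp_add]
    ring_nf
  have h4 : C * exp (-N ^ δ) * κ ≤ C * exp (-N ^ δ) * (b * exp (2 * D - N ^ δ)) := by
    have h5 : κ * exp (-D) * (C * exp (D - N ^ δ)) = κ * C * exp (-N ^ δ) := by
      rw [← h2]
      ring
    rw [h5, h3] at h1
    linarith
  have h6 := log_le_log hκ0 (le_of_mul_le_mul_left h4 (by positivity))
  rw [log_mul hb.ne' (exp_ne_zero _), log_exp] at h6
  linarith

/-- sharpness for `μ_{V_δ}`: (i) for `0 < δ ≤ 1` the super Poincaré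
inequality fails for every decreasing rate function; (ii) for `δ > 1` it fails for
every decreasing rate function with `lim_{s→0} log β(s)/log^{δ/(δ-1)}(1+s⁻¹) = 0`. -/
theorem super_poincare_Vdelta_sharp
    (d : ℕ) (hd : 1 ≤ d) (α : ℝ) (hα : 0 < α ∧ α < 2)
    (δ : ℝ) (hδ : 0 < δ) :
    (δ ≤ 1 → ∀ β : ℝ → ℝ, (∀ s, 0 < s → 0 < β s) →
      (∀ s t : ℝ, 0 < s → s ≤ t → β t ≤ β s) →
      ¬ (∀ s : ℝ, 0 < s → ∀ f : Ed d → ℝ, CbSmooth d f →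
        ∫ x, (f x) ^ 2 ∂(muV d (Vdelta d δ)) ≤ s * formE d α (Vdelta d δ) f +
          β s * (∫ x, |f x| ∂(muV d (Vdelta d δ))) ^ 2)) ∧
    (1 < δ → ∀ β : ℝ → ℝ, (∀ s, 0 < s → 0 < β s) →
      (∀ s t : ℝ, 0 < s → s ≤ t → β t ≤ β s) →
      Filter.Tendsto (fun s : ℝ => Real.log (β s) / Real.log (1 + s⁻¹) ^ (δ/(δ-1)))
        (nhdsWithin 0 (Set.Ioi 0)) (nhds 0) →
      ¬ (∀ s : ℝ, 0 < s → ∀ f : Ed d → ℝ, CbSmooth d f →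
        ∫ x, (f x) ^ 2 ∂(muV d (Vdelta d δ)) ≤ s * formE d α (Vdelta d δ) f +
          β s * (∫ x, |f x| ∂(muV d (Vdelta d δ))) ^ 2)) := by
  obtain ⟨κ, hκ, hlow⟩ := le_log_rate_of_super_poincare (d := d) hd hα.2 hδ
  refine ⟨fun hδ1 β hβ _ hSP => ?_, fun hδ1 β hβ _ hlim hSP => ?_⟩
  · have hlarge := (tendsto_rpow_atTop hδ).eventually_gt_atTop
      (log (β (κ * exp (-(3 : ℝ) ^ δ))) + 2 * 3 ^ δ - log κ)
    obtain ⟨N, hN, hN3⟩ := (hlarge.and (eventually_ge_atTop 3)).exists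
    have := hlow β hβ hSP N (3 ^ δ) hN3 (rpow_sub_le_of_le_one hδ hδ1 (by norm_num) hN3)
    linarith
  · set p := δ / (δ - 1) with hp
    have hδ0 : 0 < δ - 1 := by linarith
    have hp0 : 0 < p := by positivity
    set s : ℝ → ℝ := fun N => κ * exp (-(3 * δ * N ^ (δ - 1))) with hs
    have hspos : ∀ N, 0 < s N := fun N => by positivity
    have hs0 : Tendsto s atTop (nhdsWithin 0 (Ioi 0)) := by
      refine tendsto_nhdsWithin_iff.2 ⟨?_, Eventually.of_forall hspos⟩
      have h1 : Tendsto (fun N : ℝ => 3 * δ * N ^ (δ - 1)) atTop atTop :=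
        (tendsto_rpow_atTop hδ0).const_mul_atTop (by positivity)
      simpa using (tendsto_exp_neg_atTop_nhds_zero.comp h1).const_mul κ
    have hL : 0 < log (1 + κ⁻¹) := log_pos (by simpa using hκ)
    set A := log (1 + κ⁻¹) + 3 * δ with hA
    have hA0 : 0 < A := by positivity
    have hev := (hlim.comp hs0).eventually_le_const (show (0 : ℝ) < 1 / (2 * A ^ p) by positivity)
    obtain ⟨N, hN, hNlarge⟩ :=
      (hev.and (eventually_ge_atTop (12 * δ + 2 * |log κ| + 3))).exists
    have hκabs := abs_nonneg (log κ)
    have hN3 : 3 ≤ N := by linarith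
    have hN0 : 0 < N := by linarith
    have hlb := hlow β hβ hSP N _ hN3 (rpow_sub_le_of_one_le hδ1.le hN0 hN3)
    have hpow1 : 1 ≤ N ^ (δ - 1) := one_le_rpow (by linarith) hδ0.le
    have hlogpos : 0 < log (1 + (s N)⁻¹) := log_pos (by simpa using hspos N)
    have hlog : log (1 + (s N)⁻¹) ≤ A * N ^ (δ - 1) := by
      have h1 : 1 + (s N)⁻¹ ≤ (1 + κ⁻¹) * exp (3 * δ * N ^ (δ - 1)) := by
        have h2 : 1 ≤ exp (3 * δ * N ^ (δ - 1)) := one_le_exp (by positivity)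
        simp only [hs, mul_inv, exp_neg, inv_inv]
        linarith
      have h3 := log_le_log (by have := hspos N; positivity) h1
      rw [log_mul (by positivity) (exp_ne_zero _), log_exp] at h3
      have := mul_le_mul_of_nonneg_left hpow1 hL.le
      rw [hA, add_mul]
      linarith
    have hpowp : log (1 + (s N)⁻¹) ^ p ≤ A ^ p * N ^ δ := by
      refine (rpow_le_rpow hlogpos.le hlog hp0.le).trans_eq ?_
      rw [mul_rpow hA0.le (by positivity), ← rpow_mul hN0.le, hp, mul_div_cancel₀ _ hδ0.ne']
    have hub : log (β (s N)) ≤ N ^ δ / 2 := by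
      have h1 := (div_le_iff₀ (rpow_pos_of_pos hlogpos p)).1 hN
      refine h1.trans ((mul_le_mul_of_nonneg_left hpowp (by positivity)).trans_eq ?_)
      field_simp
    have hsplit : N ^ δ = N ^ (δ - 1) * N := by
      rw [← rpow_add_one hN0.ne', sub_add_cancel]
    have hprod : N / 2 - 6 * δ ≤ N ^ (δ - 1) * (N / 2 - 6 * δ) :=
      le_mul_of_one_le_left (by linarith) hpow1
    have hneg := neg_abs_le (log κ)
    have hcomb : N ^ δ - 2 * (3 * δ * N ^ (δ - 1)) + log κ ≤ N ^ δ / 2 := hlb.trans hub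
    rw [hsplit] at hcomb
    linarith
end
end
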